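/- Let L be an n×n real symmetric positive semidefinite matrix whose kernel is exactly span(1), let λ̃ be an eigenvalue of L, set L̃ = L − λ̃ Iₙ, and assume the kernel of L̃ is exactly span(ṽ) for some nonzero ṽ ∈ ℝⁿ and that every column l̃ⁱ of L̃ is nonzero. Let P = diag(P₁, …, Pₙ) with Pᵢ = (l̃ⁱ (l̃ⁱ)ᵀ)/((l̃ⁱ)ᵀ l̃ⁱ), and for k > 0 set M = k (L ⊗ Iₙ + P). Then M is positive semidefinite and its kernel is exactly span(1 ⊗ ṽ); in particular 0 is a simple eigenvalue of M. -/

import Mathlib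

open Matrix Kronecker

/-- Kronecker product of two vectors. -/
def vKron {m n : ℕ} (v : Fin m → ℝ) (w : Fin n → ℝ) : Fin m × Fin n → ℝ :=
  fun p => v p.1 * w p.2

/-- Rank-one projection `(v vᵀ)/(vᵀ v)`. -/
noncomputable def proj {n : ℕ} (v : Fin n → ℝ) : Matrix (Fin n) (Fin n) ℝ :=
  (v ⬝ᵥ v)⁻¹ • Matrix.vecMulVec v v

/-- `n²×n²` block-diagonal matrix with blocks `P 1, …, P n`. -/
def bdiag {n : ℕ} (P : Fin n → Matrix (Fin n) (Fin n) ℝ) :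
    Matrix (Fin n × Fin n) (Fin n × Fin n) ℝ :=
  fun p q => if p.1 = q.1 then P p.1 p.2 q.2 else 0

/-- The kernel of a sum of positive semidefinite matrices is the intersection of the kernels. -/
theorem Matrix.PosSemidef.add_mulVec_eq_zero_iff {ι : Type*} [Fintype ι] {A B : Matrix ι ι ℝ}
    (hA : A.PosSemidef) (hB : B.PosSemidef) (x : ι → ℝ) :
    (A + B) *ᵥ x = 0 ↔ A *ᵥ x = 0 ∧ B *ᵥ x = 0 := by
  constructor
  · intro h
    have hsum : star x ⬝ᵥ A *ᵥ x + star x ⬝ᵥ B *ᵥ x = 0 := by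
      rw [← dotProduct_add, ← add_mulVec, h, dotProduct_zero]
    have hAx := hA.dotProduct_mulVec_nonneg x
    have hBx := hB.dotProduct_mulVec_nonneg x
    rw [← hA.dotProduct_mulVec_zero_iff, ← hB.dotProduct_mulVec_zero_iff]
    constructor <;> linarith
  · rintro ⟨h₁, h₂⟩
    rw [add_mulVec, h₁, h₂, add_zero]

theorem kronecker_one_mulVec_apply {m n : ℕ} (A : Matrix (Fin m) (Fin m) ℝ)
    (x : Fin m × Fin n → ℝ) (i : Fin m) (j : Fin n) :
    ((A ⊗ₖ (1 : Matrix (Fin n) (Fin n) ℝ)) *ᵥ x) (i, j) = (A *ᵥ fun i' => x (i', j)) i := by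
  simp [mulVec, dotProduct, Fintype.sum_prod_type, kroneckerMap_apply, one_apply]

theorem kronecker_one_mulVec_eq_zero_iff {m n : ℕ} (A : Matrix (Fin m) (Fin m) ℝ)
    (x : Fin m × Fin n → ℝ) :
    (A ⊗ₖ (1 : Matrix (Fin n) (Fin n) ℝ)) *ᵥ x = 0 ↔ ∀ j, A *ᵥ (fun i => x (i, j)) = 0 := by
  simp only [funext_iff, Prod.forall, kronecker_one_mulVec_apply, Pi.zero_apply]
  exact forall_comm

theorem bdiag_mulVec_apply {n : ℕ} (Q : Fin n → Matrix (Fin n) (Fin n) ℝ)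
    (x : Fin n × Fin n → ℝ) (i j : Fin n) :
    (bdiag Q *ᵥ x) (i, j) = (Q i *ᵥ fun j' => x (i, j')) j := by
  simp [bdiag, mulVec, dotProduct, Fintype.sum_prod_type, ite_mul, Finset.sum_ite_irrel]

theorem bdiag_mulVec_eq_zero_iff {n : ℕ} (Q : Fin n → Matrix (Fin n) (Fin n) ℝ)
    (x : Fin n × Fin n → ℝ) :
    bdiag Q *ᵥ x = 0 ↔ ∀ i, Q i *ᵥ (fun j => x (i, j)) = 0 := by
  simp only [funext_iff, Prod.forall, bdiag_mulVec_apply, Pi.zero_apply]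

theorem posSemidef_bdiag {n : ℕ} {Q : Fin n → Matrix (Fin n) (Fin n) ℝ}
    (hQ : ∀ i, (Q i).PosSemidef) : (bdiag Q).PosSemidef := by
  refine .of_dotProduct_mulVec_nonneg ?_ fun x => ?_
  · ext ⟨i, j⟩ ⟨i', j'⟩
    rcases eq_or_ne i i' with rfl | h
    · simpa [bdiag] using (hQ i).isHermitian.apply j j'
    · simp [bdiag, h, h.symm]
  · rw [dotProduct, Fintype.sum_prod_type]
    simp only [bdiag_mulVec_apply]
    exact Finset.sum_nonneg fun i _ => (hQ i).dotProduct_mulVec_nonneg fun j => x (i, j)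

theorem posSemidef_proj {n : ℕ} (v : Fin n → ℝ) : (proj v).PosSemidef := by
  have h : (vecMulVec v v).PosSemidef := by simpa using posSemidef_vecMulVec_self_star v
  exact h.smul (inv_nonneg.mpr (Finset.sum_nonneg fun i _ => mul_self_nonneg (v i)))

theorem proj_mulVec_eq_zero_iff {n : ℕ} {v : Fin n → ℝ} (hv : v ≠ 0) (x : Fin n → ℝ) :
    proj v *ᵥ x = 0 ↔ v ⬝ᵥ x = 0 := by
  simp [proj, smul_mulVec, vecMulVec_mulVec, hv]

/-- With `L` symmetric PSD, `ker L = span(1)`, `λ̃` an eigenvalue,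
`L̃ = L − λ̃ Iₙ` with `ker L̃ = span(ṽ)` and nonzero columns, `P = diag(P₁,…,Pₙ)` and
`M = k(L ⊗ Iₙ + P)` for `k > 0`, the matrix `M` is positive semidefinite and its
kernel is exactly `span(1 ⊗ ṽ)` (so `0` is a simple eigenvalue of `M`). -/
theorem stmt9 (n : ℕ) (L : Matrix (Fin n) (Fin n) ℝ)
    (hpsd : L.PosSemidef)
    (hkerL : ∀ x : Fin n → ℝ, L *ᵥ x = 0 ↔ ∃ c : ℝ, x = c • (fun _ => (1 : ℝ)))
    (lam : ℝ) (tv : Fin n → ℝ) (htv : tv ≠ 0)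
    (heig : L *ᵥ tv = lam • tv)
    (Lt : Matrix (Fin n) (Fin n) ℝ)
    (hLt : Lt = L - lam • (1 : Matrix (Fin n) (Fin n) ℝ))
    (hkerLt : ∀ x : Fin n → ℝ, Lt *ᵥ x = 0 ↔ ∃ c : ℝ, x = c • tv)
    (hcol : ∀ i, (fun j => Lt j i) ≠ 0)
    (P : Matrix (Fin n × Fin n) (Fin n × Fin n) ℝ)
    (hP : P = bdiag (fun i => proj (fun j => Lt j i)))
    (k : ℝ) (hk : 0 < k)
    (M : Matrix (Fin n × Fin n) (Fin n × Fin n) ℝ)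
    (hM : M = k • ((L ⊗ₖ (1 : Matrix (Fin n) (Fin n) ℝ)) + P)) :
    M.PosSemidef ∧
    (∀ x : Fin n × Fin n → ℝ,
      M *ᵥ x = 0 ↔ ∃ c : ℝ, x = c • vKron (fun _ => (1 : ℝ)) tv) := by
  have hLI : (L ⊗ₖ (1 : Matrix (Fin n) (Fin n) ℝ)).PosSemidef := hpsd.kronecker .one
  have hPpsd : P.PosSemidef := hP ▸ posSemidef_bdiag fun i => posSemidef_proj _
  have hLtcol : ∀ c : Fin n → ℝ, (∀ i, (fun j => Lt j i) ⬝ᵥ c = 0) ↔ Lt *ᵥ c = 0 := by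
    intro c
    have hsymm : Ltᵀ = Lt := by
      have : Lᵀ = L := by simpa using hpsd.isHermitian.eq
      simp [hLt, this]
    nth_rewrite 2 [← hsymm]
    exact funext_iff.symm
  refine ⟨hM ▸ (hLI.add hPpsd).smul hk.le, fun x => ?_⟩
  rw [hM, smul_mulVec, smul_eq_zero_iff_right hk.ne', hLI.add_mulVec_eq_zero_iff hPpsd,
    kronecker_one_mulVec_eq_zero_iff, hP, bdiag_mulVec_eq_zero_iff]
  simp only [proj_mulVec_eq_zero_iff (hcol _), hkerL]
  constructor
  · rintro ⟨h₁, h₂⟩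
    choose c hc using h₁
    have hx : ∀ i j, x (i, j) = c j := fun i j => by simpa using congrFun (hc j) i
    simp only [hx] at h₂
    obtain ⟨a, ha⟩ := (hkerLt _).1 ((hLtcol c).1 h₂)
    exact ⟨a, funext fun ⟨i, j⟩ => by simp [hx, ha, vKron]⟩
  · rintro ⟨a, rfl⟩
    refine ⟨fun j => ⟨a * tv j, funext fun i => by simp [vKron]⟩, ?_⟩
    have h := (hLtcol (a • tv)).2 ((hkerLt _).2 ⟨a, rfl⟩)
    intro i
    convert h i using 2
    simp [vKron, funext_iff]
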